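/- arXiv:2505.14882 — 9 statements merged into one kernel-verified Lean document; each statement's English description precedes it below -/
import Mathlib

section
/- Fix an integer G ≥ 1, a real p ∈ [1,∞), a real budget T > 0, and σ ∈ ℝ^G with σ_g > 0 for all g. For every n ∈ ℝ^G with n_g > 0 for all g and Σ_{g=1}^G n_g = T, one has (Σ_{g=1}^G (σ_g²/n_g)^p)^{1/p} ≥ (1/T)·(Σ_{g=1}^G σ_g^{2p/(p+1)})^{(p+1)/p}, and equality holds if and only if n_g = T·σ_g^{2p/(p+1)} / (Σ_{h=1}^G σ_h^{2p/(p+1)}) for every g. -/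
open Finset Real

/-- Complete-information optimal allocation for finite `p`-norms: for any positive
allocation `n` with total budget `T`, the `p`-norm of the variance vector is at least
`(1/T) * (∑ σ_g^{2p/(p+1)})^{(p+1)/p}`, with equality iff `n` is the proportional
allocation `n_g = T σ_g^{2p/(p+1)} / ∑_h σ_h^{2p/(p+1)}`. -/
theorem stmt0 (G : ℕ) (hG : 1 ≤ G) (p T : ℝ) (hp : 1 ≤ p) (hT : 0 < T)
    (σ : Fin G → ℝ) (hσ : ∀ g, 0 < σ g)
    (n : Fin G → ℝ) (hn : ∀ g, 0 < n g) (hsum : ∑ g, n g = T) :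
    (1 / T) * (∑ g, σ g ^ (2 * p / (p + 1))) ^ ((p + 1) / p)
      ≤ (∑ g, (σ g ^ 2 / n g) ^ p) ^ (1 / p)
    ∧ ((∑ g, (σ g ^ 2 / n g) ^ p) ^ (1 / p)
        = (1 / T) * (∑ g, σ g ^ (2 * p / (p + 1))) ^ ((p + 1) / p)
      ↔ ∀ g, n g = T * σ g ^ (2 * p / (p + 1)) / ∑ h, σ h ^ (2 * p / (p + 1))) := by
  have hp0 : 0 < p := by linarith
  have hp1 : 0 < p + 1 := by linarith
  haveI : Nonempty (Fin G) := ⟨⟨0, hG⟩⟩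
  set a : Fin G → ℝ := fun g => σ g ^ (2 * p / (p + 1)) with ha
  have hapos : ∀ g, 0 < a g := fun g => rpow_pos_of_pos (hσ g) _
  have hapow : ∀ g, a g ^ (p + 1) = (σ g ^ 2) ^ p := by
    intro g
    rw [ha]
    simp only
    rw [← rpow_mul (hσ g).le, ← rpow_natCast (σ g) 2, ← rpow_mul (hσ g).le]
    congr 1
    push_cast
    field_simp
  change (1 / T) * (∑ g, a g) ^ ((p + 1) / p) ≤ _ ∧
    (_ = (1 / T) * (∑ g, a g) ^ ((p + 1) / p) ↔ ∀ g, n g = T * a g / ∑ h, a h)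
  set S := ∑ g, a g with hS
  have hSpos : 0 < S := Finset.sum_pos (fun g _ => hapos g) Finset.univ_nonempty
  set Q := ∑ g, (σ g ^ 2 / n g) ^ p with hQ
  have hQ0 : 0 ≤ Q := Finset.sum_nonneg fun g _ =>
    rpow_nonneg (div_nonneg (sq_nonneg _) (hn g).le) _
  have hconv := strictConvexOn_rpow (p := p + 1) (by linarith)
  have hw0 : ∀ g ∈ (Finset.univ : Finset (Fin G)), 0 < n g / T := fun g _ => div_pos (hn g) hT
  have hw1 : ∑ g, n g / T = 1 := by
    rw [← Finset.sum_div, hsum, div_self hT.ne']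
  have hmem : ∀ g ∈ (Finset.univ : Finset (Fin G)), a g / n g ∈ Set.Ici (0 : ℝ) :=
    fun g _ => (div_pos (hapos g) (hn g)).le
  have e1 : ∑ g, (n g / T) • (a g / n g) = S / T := by
    rw [hS, Finset.sum_div]
    refine Finset.sum_congr rfl fun g _ => ?_
    have := (hn g).ne'
    rw [smul_eq_mul]
    field_simp
  have e2 : ∑ g, (n g / T) • ((a g / n g) ^ (p + 1)) = Q / T := by
    rw [hQ, Finset.sum_div]
    refine Finset.sum_congr rfl fun g _ => ?_
    have h1 := (hn g).ne'
    have h2 := (rpow_pos_of_pos (hn g) p).ne'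
    rw [smul_eq_mul, div_rpow (hapos g).le (hn g).le, hapow, div_rpow (sq_nonneg _) (hn g).le,
      rpow_add_one h1]
    field_simp
  have hle := hconv.convexOn.map_sum_le (fun g hg => (hw0 g hg).le) hw1 hmem
  have heq := hconv.map_sum_eq_iff_of_pos hw0 hw1 hmem
  simp only [e1, e2] at hle heq
  have hB0 : 0 ≤ T * (S / T) ^ (p + 1) := by positivity
  have e3 : (1 / T) * S ^ ((p + 1) / p) = (T * (S / T) ^ (p + 1)) ^ (1 / p) := by
    have hT' : T * (S / T) ^ (p + 1) = S ^ (p + 1) / T ^ p := by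
      have h2 := (rpow_pos_of_pos hT p).ne'
      rw [div_rpow hSpos.le hT.le, rpow_add_one hT.ne']
      field_simp
    rw [hT', div_rpow (by positivity) (by positivity), ← rpow_mul hSpos.le, ← rpow_mul hT.le,
      mul_one_div_cancel hp0.ne', rpow_one, mul_one_div]
    ring
  have hle' : T * (S / T) ^ (p + 1) ≤ Q := by
    rw [le_div_iff₀ hT] at hle
    linarith
  rw [e3]
  refine ⟨rpow_le_rpow hB0 hle' (by positivity), ?_⟩
  rw [rpow_left_inj hQ0 hB0 (by positivity)]
  have step : Q = T * (S / T) ^ (p + 1) ↔ (S / T) ^ (p + 1) = Q / T := by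
    rw [eq_div_iff hT.ne', mul_comm T]
    exact eq_comm
  rw [step, heq]
  constructor
  · intro h g
    have h3 : S = (a g / n g) * T := by
      rw [hS, ← hsum, Finset.mul_sum]
      refine Finset.sum_congr rfl fun k _ => ?_
      rw [h (Finset.mem_univ g) (Finset.mem_univ k), div_mul_cancel₀ _ (hn k).ne']
    have h1 := (hn g).ne'
    rw [eq_div_iff hSpos.ne', h3]
    field_simp
  · intro h
    have key : ∀ g, a g / n g = S / T := by
      intro g
      have h1 := (hapos g).ne'
      rw [h g]
      field_simp
    intro j _ k _
    rw [key j, key k]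
end

section
/- Let (Ω, ℱ, ℙ) be a probability space, G ≥ 1 an integer, p ∈ [1,∞) a real, T ≥ 0 a real, and λ* ∈ Δ_G with λ*_g > 0 for all g. Let Λ : Ω → Δ_G be a random element with Λ_g > 0 almost surely, set δ_g := 1 − Λ_g/λ*_g, and suppose the random variable V := (Σ_{g=1}^G λ*_g·(1−δ_g)^{−p})^{1/p} − 1 satisfies V ≤ T almost surely. Then for all a, b ∈ ℝ^G with a_g ≤ 0 ≤ b_g for all g and b_max := max_g b_g < 1, one has E[V] ≤ ℙ(not (a_g ≤ δ_g ≤ b_g for all g))·T + (p+1)/2·Σ_{g=1}^G λ*_g(a_g² + b_g²) + p²·max(‖a‖_∞, ‖b‖_∞)³/(1−b_max)^{3p+3}. -/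
open MeasureTheory Finset Real

lemma aux_mono (f f' : ℝ → ℝ) (β : ℝ) (h0 : f 0 = 0)
    (hd : ∀ x, 0 ≤ x → x ≤ β → HasDerivAt f (f' x) x)
    (hn : ∀ x, 0 ≤ x → x ≤ β → 0 ≤ f' x) (x : ℝ) (hx : 0 ≤ x) (hxb : x ≤ β) : 0 ≤ f x := by
  have hm : MonotoneOn f (Set.Icc 0 β) := by
    apply monotoneOn_of_hasDerivWithinAt_nonneg (f' := f') (convex_Icc 0 β)
    · intro y hy
      exact (hd y hy.1 hy.2).continuousAt.continuousWithinAt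
    · intro y hy
      rw [interior_Icc] at hy
      exact (hd y hy.1.le hy.2.le).hasDerivWithinAt
    · intro y hy
      rw [interior_Icc] at hy
      exact hn y hy.1.le hy.2.le
  have := hm (Set.mem_Icc.2 ⟨le_rfl, hx.trans hxb⟩) (Set.mem_Icc.2 ⟨hx, hxb⟩) hx
  linarith

lemma aux_deriv (p x : ℝ) (hx : x < 1) :
    HasDerivAt (fun y : ℝ => (1 - y) ^ (-p)) (p * (1 - x) ^ (-(p + 1))) x := by
  have h1 : HasDerivAt (fun y : ℝ => 1 - y) (-1) x := by
    simpa using (hasDerivAt_id x).const_sub 1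
  have := h1.rpow_const (p := -p) (Or.inl (by linarith : (1 - x) ≠ 0 ))
  convert this using 1
  rw [show -p - 1 = -(p + 1) by ring]
  ring

lemma aux_poly (c0 c1 c2 c3 x : ℝ) :
    HasDerivAt (fun y : ℝ => c0 + c1 * y + c2 * y ^ 2 + c3 * y ^ 3)
      (c1 + 2 * c2 * x + 3 * c3 * x ^ 2) x := by
  have h1 := (hasDerivAt_id x).const_mul c1
  have h2 := (hasDerivAt_pow 2 x).const_mul c2
  have h3 := (hasDerivAt_pow 3 x).const_mul c3
  have := ((h1.const_add c0).add h2).add h3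
  refine this.congr_deriv ?_
  norm_num
  ring

lemma aux_C (r x β : ℝ) (hr : 0 ≤ r) (hx : x ≤ β) (hβ : β < 1) :
    (1 - x) ^ (-r) ≤ (1 - β) ^ (-r) :=
  Real.rpow_le_rpow_of_nonpos (by linarith) (by linarith) (by linarith)

lemma aux1 (r β C : ℝ) (hr : 0 ≤ r) (hβ : β < 1) (hC : (1 - β) ^ (-(r + 1)) ≤ C)
    (x : ℝ) (hx : 0 ≤ x) (hxb : x ≤ β) : (1 - x) ^ (-r) ≤ 1 + r * C * x := by
  have := aux_mono (fun y => (1 + r * C * y + 0 * y ^ 2 + 0 * y ^ 3) - (1 - y) ^ (-r))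
    (fun y => (r * C + 2 * 0 * y + 3 * 0 * y ^ 2) - r * (1 - y) ^ (-(r + 1))) β (by simp)
    (fun y _ h => (aux_poly _ _ _ _ y).sub (aux_deriv r y (by linarith)))
    (fun y _ h => by
      have h1 := aux_C (r + 1) y β (by linarith) h hβ
      nlinarith [mul_le_mul_of_nonneg_left (h1.trans hC) hr]) x hx hxb
  linarith

lemma aux2 (r β C : ℝ) (hr : 0 ≤ r) (hβ : β < 1) (hC : (1 - β) ^ (-(r + 2)) ≤ C)
    (x : ℝ) (hx : 0 ≤ x) (hxb : x ≤ β) :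
    (1 - x) ^ (-r) ≤ 1 + r * x + r * (r + 1) / 2 * C * x ^ 2 := by
  have := aux_mono (fun y => (1 + r * y + (r * (r + 1) / 2 * C) * y ^ 2 + 0 * y ^ 3)
      - (1 - y) ^ (-r))
    (fun y => (r + 2 * (r * (r + 1) / 2 * C) * y + 3 * 0 * y ^ 2)
      - r * (1 - y) ^ (-(r + 1))) β (by simp)
    (fun y _ h => (aux_poly _ _ _ _ y).sub (aux_deriv r y (by linarith)))
    (fun y h0 h => by
      have h1 := aux1 (r + 1) β C (by linarith) hβ
        (by rw [show r + 1 + 1 = r + 2 by ring]; exact hC) y h0 h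
      nlinarith [mul_le_mul_of_nonneg_left h1 hr]) x hx hxb
  linarith

lemma aux3 (r β C : ℝ) (hr : 0 ≤ r) (hβ : β < 1) (hC : (1 - β) ^ (-(r + 3)) ≤ C)
    (x : ℝ) (hx : 0 ≤ x) (hxb : x ≤ β) :
    (1 - x) ^ (-r) ≤ 1 + r * x + r * (r + 1) / 2 * x ^ 2
      + r * (r + 1) * (r + 2) / 6 * C * x ^ 3 := by
  have := aux_mono (fun y => (1 + r * y + (r * (r + 1) / 2) * y ^ 2
      + (r * (r + 1) * (r + 2) / 6 * C) * y ^ 3) - (1 - y) ^ (-r))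
    (fun y => (r + 2 * (r * (r + 1) / 2) * y + 3 * (r * (r + 1) * (r + 2) / 6 * C) * y ^ 2)
      - r * (1 - y) ^ (-(r + 1))) β (by simp)
    (fun y _ h => (aux_poly _ _ _ _ y).sub (aux_deriv r y (by linarith)))
    (fun y h0 h => by
      have h1 := aux2 (r + 1) β C (by linarith) hβ
        (by rw [show r + 1 + 2 = r + 3 by ring]; exact hC) y h0 h
      nlinarith [mul_le_mul_of_nonneg_left h1 hr]) x hx hxb
  linarith

/-- Bernoulli with negative exponent. -/
lemma aux_bern (r x : ℝ) (hr : 0 ≤ r) (hx : x < 1) : 1 + r * x ≤ (1 - x) ^ (-r) := by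
  have h := Real.add_one_le_exp (r * x)
  have h2 : Real.log (1 - x) ≤ - x := by
    have := Real.log_le_sub_one_of_pos (show 0 < 1 - x by linarith)
    linarith
  rw [Real.rpow_def_of_pos (by linarith)]
  have h3 : r * x ≤ Real.log (1 - x) * (-r) := by nlinarith
  linarith [Real.exp_le_exp.2 h3]

lemma aux_neg (r x : ℝ) (hr : 0 ≤ r) (hx : x ≤ 0) :
    (1 - x) ^ (-r) ≤ 1 + r * x + r * (r + 1) / 2 * x ^ 2 := by
  have := aux_mono (fun y => (1 + (-r) * y + (r * (r + 1) / 2) * y ^ 2 + 0 * y ^ 3)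
      - (1 + y) ^ (-r))
    (fun y => ((-r) + 2 * (r * (r + 1) / 2) * y + 3 * 0 * y ^ 2)
      - (-(r * (1 + y) ^ (-(r + 1))))) (-x) (by simp)
    (fun y h0 h => (aux_poly _ _ _ _ y).sub (by
      have h1 := (aux_deriv r (-y) (by linarith)).comp y (hasDerivAt_neg y)
      simpa [Function.comp_def] using h1))
    (fun y h0 h => by
      have h1 := aux_bern (r + 1) (-y) (by linarith) (by linarith)
      rw [sub_neg_eq_add] at h1
      nlinarith [mul_le_mul_of_nonneg_left h1 hr]) (-x) (by linarith) le_rfl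
  simp only [← sub_eq_add_neg] at this
  nlinarith

lemma aux_scalar (p β M x : ℝ) (hp : 1 ≤ p) (hβ0 : 0 ≤ β) (hβ : β < 1) (hxb : x ≤ β)
    (hM : 0 ≤ M) (hxM : x ≤ M) :
    (1 - x) ^ (-p) ≤ 1 + p * x + p * ((p + 1) / 2 * x ^ 2
      + p ^ 2 * M ^ 3 / (1 - β) ^ (3 * p + 3)) := by
  have hpos : 0 < (1 - β) ^ (3 * p + 3) := Real.rpow_pos_of_pos (by linarith) _
  rcases le_total x 0 with h | h
  · have h1 := aux_neg p x (by linarith) h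
    have h2 : 0 ≤ p * (p ^ 2 * M ^ 3 / (1 - β) ^ (3 * p + 3)) := by positivity
    linarith
  · have hC : (1 - β) ^ (-(p + 3)) ≤ (1 - β) ^ (-(3 * p + 3)) :=
      Real.rpow_le_rpow_of_exponent_ge (by linarith) (by linarith) (by linarith)
    have h1 := aux3 p β _ (by linarith) hβ hC x h hxb
    rw [Real.rpow_neg (by linarith) (3 * p + 3)] at h1
    have hi : 0 < ((1 - β) ^ (3 * p + 3))⁻¹ := inv_pos.2 hpos
    rw [div_eq_mul_inv (p ^ 2 * M ^ 3)]
    generalize ((1 - β) ^ (3 * p + 3))⁻¹ = C at *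
    have hx3 : x ^ 3 ≤ M ^ 3 := pow_le_pow_left₀ h hxM 3
    have hq : (p + 1) * (p + 2) / 6 ≤ p ^ 2 := by nlinarith
    have h5 : (p + 1) * (p + 2) / 6 * x ^ 3 ≤ p ^ 2 * M ^ 3 :=
      mul_le_mul hq hx3 (by positivity) (by positivity)
    have h6 := mul_le_mul_of_nonneg_left (mul_le_mul_of_nonneg_right h5 hi.le)
      (show 0 ≤ p by linarith)
    linarith

/-- Regret analysis scheme for finite `p`-norms: if the normalized excess
`V = (∑ λ*_g (1-δ_g)^{-p})^{1/p} - 1` is a.s. at most `T`, then for any `a ≤ 0 ≤ b`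
with `b_max < 1`,
`E[V] ≤ ℙ(¬(a ≤ δ ≤ b))·T + (p+1)/2 ∑ λ*_g(a_g²+b_g²)
       + p² max(‖a‖_∞,‖b‖_∞)³/(1-b_max)^{3p+3}`. -/
theorem stmt5 {Ω : Type*} [MeasurableSpace Ω] (P : Measure Ω) [IsProbabilityMeasure P]
    (G : ℕ) [Nonempty (Fin G)] (hG : 1 ≤ G) (p T : ℝ) (hp : 1 ≤ p) (hT : 0 ≤ T)
    (lamstar : Fin G → ℝ) (hls : ∀ g, 0 < lamstar g) (hlssum : ∑ g, lamstar g = 1)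
    (Λ : Ω → Fin G → ℝ) (hmeas : ∀ g, Measurable fun ω => Λ ω g)
    (hΛ : ∀ᵐ ω ∂P, (∀ g, 0 < Λ ω g) ∧ (∀ g, 0 ≤ Λ ω g) ∧ ∑ g, Λ ω g = 1)
    (δ : Ω → Fin G → ℝ) (hδ : ∀ ω g, δ ω g = 1 - Λ ω g / lamstar g)
    (V : Ω → ℝ)
    (hV : ∀ ω, V ω = (∑ g, lamstar g * (1 - δ ω g) ^ (-p)) ^ (1 / p) - 1)
    (hVT : ∀ᵐ ω ∂P, V ω ≤ T)
    (a b : Fin G → ℝ) (hab : ∀ g, a g ≤ 0 ∧ 0 ≤ b g)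
    (bmax : ℝ) (hbmax : bmax = Finset.univ.sup' Finset.univ_nonempty b)
    (hb1 : bmax < 1) :
    ∫ ω, V ω ∂P
      ≤ (P {ω | ¬ ∀ g, a g ≤ δ ω g ∧ δ ω g ≤ b g}).toReal * T
        + (p + 1) / 2 * ∑ g, lamstar g * ((a g) ^ 2 + (b g) ^ 2)
        + p ^ 2 * (max (Finset.univ.sup' Finset.univ_nonempty fun g => |a g|)
            (Finset.univ.sup' Finset.univ_nonempty fun g => |b g|)) ^ 3
          / (1 - bmax) ^ (3 * p + 3) := by
  set M := max (Finset.univ.sup' Finset.univ_nonempty fun g => |a g|)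
            (Finset.univ.sup' Finset.univ_nonempty fun g => |b g|) with hMdef
  have hp0 : 0 < p := by linarith
  have hbM : ∀ g, b g ≤ M := fun g =>
    (le_abs_self _).trans ((Finset.le_sup' (fun g => |b g|) (Finset.mem_univ g)).trans
      (le_max_right _ _))
  have hbb : ∀ g, b g ≤ bmax := fun g => by
    rw [hbmax]; exact Finset.le_sup' b (Finset.mem_univ g)
  obtain ⟨g0⟩ := (inferInstance : Nonempty (Fin G))
  have hM0 : 0 ≤ M := (hab g0).2.trans (hbM g0)
  have hbm0 : 0 ≤ bmax := (hab g0).2.trans (hbb g0)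
  have hpos : 0 < (1 - bmax) ^ (3 * p + 3) := Real.rpow_pos_of_pos (by linarith) _
  set Q := p ^ 2 * M ^ 3 / (1 - bmax) ^ (3 * p + 3) with hQ
  have hQ0 : 0 ≤ Q := by positivity
  set R := (p + 1) / 2 * ∑ g, lamstar g * ((a g) ^ 2 + (b g) ^ 2) with hR
  have hR0 : 0 ≤ R := mul_nonneg (by linarith)
    (Finset.sum_nonneg fun g _ => mul_nonneg (hls g).le (by positivity))
  set S := {ω | ¬ ∀ g, a g ≤ δ ω g ∧ δ ω g ≤ b g} with hS
  have hδm : ∀ g, Measurable fun ω => δ ω g := fun g => by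
    simp only [hδ]
    exact measurable_const.sub ((hmeas g).div_const _)
  have hSm : MeasurableSet S := by
    have h1 : MeasurableSet (⋂ g, ({ω | a g ≤ δ ω g} ∩ {ω | δ ω g ≤ b g})) :=
      MeasurableSet.iInter fun g =>
        (measurableSet_le measurable_const (hδm g)).inter
          (measurableSet_le (hδm g) measurable_const)
    convert h1.compl using 1
    ext ω
    simp [hS]
  have hsum : ∀ ω, ∑ g, Λ ω g = 1 → ∑ g, lamstar g * δ ω g = 0 := by
    intro ω h
    have : ∀ g, lamstar g * δ ω g = lamstar g - Λ ω g := fun g => by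
      rw [hδ]; have := (hls g).ne'; field_simp
    simp only [this, Finset.sum_sub_distrib, h, hlssum, sub_self]
  have hlt : ∀ ω, (∀ g, 0 < Λ ω g) → ∀ g, δ ω g < 1 := fun ω h g => by
    rw [hδ]; linarith [div_pos (h g) (hls g)]
  have hge : ∀ ω, (∀ g, 0 < Λ ω g) → ∑ g, Λ ω g = 1 →
      1 ≤ ∑ g, lamstar g * (1 - δ ω g) ^ (-p) := by
    intro ω h1 h2
    calc (1 : ℝ) = ∑ g, lamstar g * (1 + p * δ ω g) := by
          have : ∀ g, lamstar g * (1 + p * δ ω g) = lamstar g + p * (lamstar g * δ ω g) :=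
            fun g => by ring
          simp only [this, Finset.sum_add_distrib, ← Finset.mul_sum, hsum ω h2, hlssum]
          ring
      _ ≤ _ := Finset.sum_le_sum fun g _ =>
          mul_le_mul_of_nonneg_left (aux_bern p _ hp0.le (hlt ω h1 g)) (hls g).le
  have hfin : ∫ ω, (S.indicator (fun _ => T) ω + (R + Q)) ∂P
      = (P S).toReal * T + R + Q := by
    rw [integral_add ((integrable_const T).indicator hSm) (integrable_const _),
      integral_indicator_const _ hSm]
    simp [Measure.real]
    ring
  rw [← hfin]
  apply integral_mono_of_nonneg
  · filter_upwards [hΛ] with ω h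
    have := Real.one_le_rpow (hge ω h.1 h.2.2) (show 0 ≤ 1 / p by positivity)
    simp only [Pi.zero_apply, hV]
    linarith
  · exact ((integrable_const T).indicator hSm).add (integrable_const _)
  · filter_upwards [hΛ, hVT] with ω h hT'
    by_cases hω : ω ∈ S
    · simp only [Set.indicator_of_mem hω]
      linarith
    · simp only [Set.indicator_of_notMem hω, zero_add]
      have hω' : ∀ g, a g ≤ δ ω g ∧ δ ω g ≤ b g := by
        by_contra hc
        exact hω hc
      have h1 := hge ω h.1 h.2.2
      have h2 : ∑ g, lamstar g * (1 - δ ω g) ^ (-p) ≤ 1 + p * (R + Q) := by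
        calc _ ≤ ∑ g, lamstar g * (1 + p * δ ω g
                + p * ((p + 1) / 2 * ((a g) ^ 2 + (b g) ^ 2) + Q)) := by
              refine Finset.sum_le_sum fun g _ => mul_le_mul_of_nonneg_left ?_ (hls g).le
              have h3 := aux_scalar p bmax M (δ ω g) hp hbm0 hb1 ((hω' g).2.trans (hbb g)) hM0
                ((hω' g).2.trans (hbM g))
              have h4 : (δ ω g) ^ 2 ≤ (a g) ^ 2 + (b g) ^ 2 := by
                rcases le_total (δ ω g) 0 with h | h
                · nlinarith [(hω' g).1, sq_nonneg (b g)]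
                · nlinarith [(hω' g).2, sq_nonneg (a g)]
              have h5 := mul_le_mul_of_nonneg_left h4 (show 0 ≤ p * ((p + 1) / 2) by positivity)
              rw [← hQ] at h3
              linarith
          _ = _ := by
              have : ∀ g, lamstar g * (1 + p * δ ω g
                + p * ((p + 1) / 2 * ((a g) ^ 2 + (b g) ^ 2) + Q))
                = lamstar g + p * (lamstar g * δ ω g)
                  + p * ((p + 1) / 2) * (lamstar g * ((a g) ^ 2 + (b g) ^ 2))
                  + p * Q * lamstar g := fun g => by ring
              simp only [this, Finset.sum_add_distrib, ← Finset.mul_sum, hsum ω h.2.2, hlssum]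
              rw [hR]
              ring
      rw [hV]
      have h6 : (∑ g, lamstar g * (1 - δ ω g) ^ (-p)) ^ (1 / p) ≤ 1 + (R + Q) := by
        rw [one_div, Real.rpow_inv_le_iff_of_pos (by linarith) (by linarith) hp0]
        exact h2.trans (one_add_mul_self_le_rpow_one_add (by linarith) hp)
      linarith
end

section
/- Let G ≥ 1 be an integer, p ∈ [1,∞) a real, and λ, λ* ∈ Δ_G with λ*_g > 0 and λ_g > 0 for all g. Set δ_g := 1 − λ_g/λ*_g, δ_max := max_g δ_g, and ‖δ‖_∞ := max_g |δ_g|. Then |(Σ_{g=1}^G λ*_g·(1−δ_g)^{−p})^{1/p} − 1 − (p+1)/2·Σ_{g=1}^G λ*_g·δ_g²| ≤ p²·‖δ‖_∞³/(1−δ_max)^{3p+3}. -/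
open Finset Real

lemma step_bd (g g' B B' : ℝ → ℝ) (h0 : g 0 = 0) (hB0 : B 0 = 0)
    (hg : ∀ t ∈ Set.Icc (0:ℝ) 1, HasDerivAt g (g' t) t)
    (hB : ∀ t, HasDerivAt B (B' t) t)
    (hb : ∀ t ∈ Set.Icc (0:ℝ) 1, |g' t| ≤ B' t) :
    ∀ t ∈ Set.Icc (0:ℝ) 1, |g t| ≤ B t := by
  intro t ht
  have := image_norm_le_of_norm_deriv_right_le_deriv_boundary (f := g) (f' := g') (a := 0) (b := 1)
    (B := B) (B' := B')
    (fun x hx => (hg x hx).continuousAt.continuousWithinAt)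
    (fun x hx => (hg x ⟨hx.1, hx.2.le⟩).hasDerivWithinAt) (by simp [h0, hB0]) hB
    (fun x hx => hb x ⟨hx.1, hx.2.le⟩) ht
  simpa using this

lemma taylor3 (f f1 f2 f3 : ℝ → ℝ) (K : ℝ)
    (h1 : ∀ t ∈ Set.Icc (0:ℝ) 1, HasDerivAt f (f1 t) t)
    (h2 : ∀ t ∈ Set.Icc (0:ℝ) 1, HasDerivAt f1 (f2 t) t)
    (h3 : ∀ t ∈ Set.Icc (0:ℝ) 1, HasDerivAt f2 (f3 t) t)
    (hK : ∀ t ∈ Set.Icc (0:ℝ) 1, |f3 t| ≤ 6 * K) :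
    |f 1 - f 0 - f1 0 - f2 0 / 2| ≤ K := by
  have a2 := step_bd (fun t => f2 t - f2 0) f3 (fun t => 6 * K * t) (fun _ => 6 * K)
    (by simp) (by simp) (fun t ht => (h3 t ht).sub_const _)
    (fun t => by simpa using (hasDerivAt_id t).const_mul (6 * K)) hK
  have a1 := step_bd (fun t => f1 t - f1 0 - f2 0 * t) (fun t => f2 t - f2 0)
    (fun t => 3 * K * t ^ 2) (fun t => 6 * K * t)
    (by simp) (by simp)
    (fun t ht => by
      simpa using ((h2 t ht).sub_const (f1 0)).fun_sub ((hasDerivAt_id t).const_mul (f2 0)))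
    (fun t => by
      refine HasDerivAt.congr_deriv ((hasDerivAt_pow 2 t).const_mul (3 * K)) ?_
      norm_num; ring) a2
  have a0 := step_bd (fun t => f t - f 0 - f1 0 * t - f2 0 / 2 * t ^ 2)
    (fun t => f1 t - f1 0 - f2 0 * t)
    (fun t => K * t ^ 3) (fun t => 3 * K * t ^ 2)
    (by simp) (by simp)
    (fun t ht => by
      refine HasDerivAt.congr_deriv ((((h1 t ht).sub_const (f 0)).fun_sub ((hasDerivAt_id t).const_mul (f1 0))).fun_sub
        ((hasDerivAt_pow 2 t).const_mul (f2 0 / 2))) ?_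
      norm_num; ring)
    (fun t => by
      refine HasDerivAt.congr_deriv ((hasDerivAt_pow 3 t).const_mul K) ?_
      norm_num; ring) a1
  simpa using a0 1 (by simp)

noncomputable def SS {G : ℕ} (w δ : Fin G → ℝ) (p : ℝ) (k : ℕ) (t : ℝ) : ℝ :=
  ∑ g, w g * δ g ^ k * (1 - t * δ g) ^ (-(p + k))

lemma SS_deriv {G : ℕ} (w δ : Fin G → ℝ) (p : ℝ) (k : ℕ) (t : ℝ)
    (h : ∀ g, 0 < 1 - t * δ g) :
    HasDerivAt (SS w δ p k) ((p + k) * SS w δ p (k + 1) t) t := by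
  unfold SS
  rw [Finset.mul_sum]
  apply HasDerivAt.fun_sum
  intro g _
  have h1 : HasDerivAt (fun t => 1 - t * δ g) (-δ g) t := by
    simpa using ((hasDerivAt_id t).mul_const (δ g)).const_sub 1
  have h2 := (h1.rpow_const (p := -(p + k)) (Or.inl (h g).ne')).const_mul (w g * δ g ^ k)
  refine HasDerivAt.congr_deriv (h2) ?_
  have : -(p + ((k + 1 : ℕ) : ℝ)) = -(p + k) - 1 := by push_cast; ring
  rw [this]; ring

lemma SS_bd {G : ℕ} (w δ : Fin G → ℝ) (hw : ∀ g, 0 ≤ w g) (hs : ∑ g, w g = 1)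
    (p : ℝ) (hp : 1 ≤ p) (k : ℕ) (t c N : ℝ) (hc : 0 < c)
    (h : ∀ g, c ≤ 1 - t * δ g) (hN : ∀ g, |δ g| ≤ N) :
    |SS w δ p k t| ≤ N ^ k * (c ^ (-p) * c⁻¹ ^ k) := by
  have e : c ^ (-p) * c⁻¹ ^ k = c ^ (-(p + k)) := by
    rw [neg_add, rpow_add hc, rpow_neg hc.le (k : ℝ), rpow_natCast, inv_pow]
  rw [e]
  calc |SS w δ p k t| ≤ ∑ g, |w g * δ g ^ k * (1 - t * δ g) ^ (-(p + k))| :=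
        Finset.abs_sum_le_sum_abs _ _
    _ ≤ ∑ g, w g * (N ^ k * c ^ (-(p + k))) := by
        apply Finset.sum_le_sum
        intro g _
        have hpos := hc.trans_le (h g)
        rw [abs_mul, abs_mul, abs_of_nonneg (hw g), abs_pow, mul_assoc,
          abs_of_pos (rpow_pos_of_pos hpos _)]
        apply mul_le_mul_of_nonneg_left _ (hw g)
        apply mul_le_mul (pow_le_pow_left₀ (abs_nonneg _) (hN g) k) _
          (rpow_pos_of_pos hpos _).le (pow_nonneg ((abs_nonneg _).trans (hN g)) k)
        apply rpow_le_rpow_of_nonpos hc (h g)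
        have : (0:ℝ) ≤ k := Nat.cast_nonneg k
        linarith
    _ = _ := by rw [← Finset.sum_mul, hs, one_mul]

lemma SS_ge {G : ℕ} (w δ : Fin G → ℝ) (hw : ∀ g, 0 ≤ w g) (hs : ∑ g, w g = 1)
    (hm : ∑ g, w g * δ g = 0)
    (p : ℝ) (hp : 1 ≤ p) (t : ℝ) (h : ∀ g, 0 < 1 - t * δ g) :
    1 ≤ SS w δ p 0 t := by
  have : ∑ g, w g * (1 + p * t * δ g) ≤ SS w δ p 0 t := by
    apply Finset.sum_le_sum
    intro g _
    simp only [pow_zero, mul_one, Nat.cast_zero, add_zero]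
    apply mul_le_mul_of_nonneg_left _ (hw g)
    rw [rpow_def_of_pos (h g)]
    have a := Real.add_one_le_exp (Real.log (1 - t * δ g) * -p)
    have b := Real.log_le_sub_one_of_pos (h g)
    nlinarith
  have e : ∑ g, w g * (1 + p * t * δ g) = 1 := by
    have : ∀ g, w g * (1 + p * t * δ g) = w g + p * t * (w g * δ g) := fun g => by ring
    simp only [this]
    rw [Finset.sum_add_distrib, ← Finset.mul_sum, hs, hm]; ring
  linarith

lemma alg_bd (p N u v q1 q2 q3 S1 S2 S3 : ℝ) (hp : 1 ≤ p) (hN : 0 ≤ N) (hu : 1 ≤ u) (hv : 0 ≤ v)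
    (a1 : 0 ≤ q1) (b1 : q1 ≤ 1) (a2 : 0 ≤ q2) (b2 : q2 ≤ 1) (a3 : 0 ≤ q3) (b3 : q3 ≤ 1)
    (h1 : |S1| ≤ N ^ 1 * (u * v ^ 1)) (h2 : |S2| ≤ N ^ 2 * (u * v ^ 2))
    (h3 : |S3| ≤ N ^ 3 * (u * v ^ 3)) :
    |(p + 1) * (p + 2) * (q1 * S3) + 3 * ((1 - p) * (p + 1)) * (q2 * (S1 * S2))
      + (1 - p) * (1 - 2 * p) * (q3 * S1 ^ 3)| ≤ 6 * (p ^ 2 * (N ^ 3 * (u ^ 3 * v ^ 3))) := by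
  set M := N ^ 3 * (u ^ 3 * v ^ 3) with hM
  have hu0 : 0 ≤ u := by linarith
  have key : ∀ q x : ℝ, 0 ≤ q → q ≤ 1 → |x| ≤ M → |q * x| ≤ M := by
    intro q x hq hq1 hx
    rw [abs_mul, abs_of_nonneg hq]
    nlinarith [abs_nonneg x]
  have hnv : 0 ≤ N ^ 3 * v ^ 3 := by positivity
  have k3 : |S3| ≤ M := h3.trans (by
    have : u ≤ u ^ 3 := le_self_pow₀ hu (by norm_num)
    calc N ^ 3 * (u * v ^ 3) = N ^ 3 * v ^ 3 * u := by ring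
      _ ≤ N ^ 3 * v ^ 3 * u ^ 3 := mul_le_mul_of_nonneg_left this hnv
      _ = M := by rw [hM]; ring)
  have k2 : |S1 * S2| ≤ M := by
    have : u ^ 2 ≤ u ^ 3 := pow_le_pow_right₀ hu (by norm_num)
    rw [abs_mul]
    calc |S1| * |S2| ≤ (N ^ 1 * (u * v ^ 1)) * (N ^ 2 * (u * v ^ 2)) :=
          mul_le_mul h1 h2 (abs_nonneg _) (by positivity)
      _ = N ^ 3 * v ^ 3 * u ^ 2 := by ring
      _ ≤ N ^ 3 * v ^ 3 * u ^ 3 := mul_le_mul_of_nonneg_left this hnv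
      _ = M := by rw [hM]; ring
  have k1 : |S1 ^ 3| ≤ M := by
    rw [abs_pow]
    calc |S1| ^ 3 ≤ (N ^ 1 * (u * v ^ 1)) ^ 3 := pow_le_pow_left₀ (abs_nonneg _) h1 3
      _ = M := by rw [hM]; ring
  have l3 := abs_le.1 (key q1 _ a1 b1 k3)
  have l2 := abs_le.1 (key q2 _ a2 b2 k2)
  have l1 := abs_le.1 (key q3 _ a3 b3 k1)
  have c3 : 0 ≤ (p + 1) * (p + 2) := by positivity
  have c2 : 0 ≤ 3 * ((p - 1) * (p + 1)) := by
    have : 0 ≤ p - 1 := by linarith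
    positivity
  have c1 : 0 ≤ (p - 1) * (2 * p - 1) := mul_nonneg (by linarith) (by linarith)
  have m3 := mul_le_mul_of_nonneg_left l3.1 c3
  have m3' := mul_le_mul_of_nonneg_left l3.2 c3
  have m2 := mul_le_mul_of_nonneg_left l2.1 c2
  have m2' := mul_le_mul_of_nonneg_left l2.2 c2
  have m1 := mul_le_mul_of_nonneg_left l1.1 c1
  have m1' := mul_le_mul_of_nonneg_left l1.2 c1
  rw [abs_le]
  constructor <;> linarith

/-- Taylor inequality for the normalized performance ratio (Proposition on finite `p`):
`|(∑ λ*_g (1-δ_g)^{-p})^{1/p} - 1 - (p+1)/2 ∑ λ*_g δ_g²| ≤ p² ‖δ‖_∞³/(1-δ_max)^{3p+3}`. -/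
theorem stmt6 (G : ℕ) [Nonempty (Fin G)] (hG : 1 ≤ G) (p : ℝ) (hp : 1 ≤ p)
    (lam lamstar : Fin G → ℝ)
    (hlam : ∀ g, 0 < lam g) (hlamsum : ∑ g, lam g = 1)
    (hls : ∀ g, 0 < lamstar g) (hlssum : ∑ g, lamstar g = 1)
    (δ : Fin G → ℝ) (hδ : ∀ g, δ g = 1 - lam g / lamstar g)
    (δmax : ℝ) (hδmax : δmax = Finset.univ.sup' Finset.univ_nonempty δ) :
    |(∑ g, lamstar g * (1 - δ g) ^ (-p)) ^ (1 / p) - 1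
        - (p + 1) / 2 * ∑ g, lamstar g * (δ g) ^ 2|
      ≤ p ^ 2 * (Finset.univ.sup' Finset.univ_nonempty fun g => |δ g|) ^ 3
          / (1 - δmax) ^ (3 * p + 3) := by
  have hp0 : p ≠ 0 := by linarith
  have hw : ∀ g, 0 ≤ lamstar g := fun g => (hls g).le
  have hm : ∑ g, lamstar g * δ g = 0 := by
    have : ∀ g, lamstar g * δ g = lamstar g - lam g := fun g => by
      rw [hδ]; have := (hls g).ne'; field_simp
    simp only [this, Finset.sum_sub_distrib, hlssum, hlamsum, sub_self]
  have hle : ∀ g, δ g ≤ δmax := fun g => by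
    rw [hδmax]; exact Finset.le_sup' δ (Finset.mem_univ g)
  have hD0 : 0 ≤ δmax := by
    have : ∑ g, lamstar g * δ g ≤ ∑ g, lamstar g * δmax :=
      Finset.sum_le_sum fun g _ => mul_le_mul_of_nonneg_left (hle g) (hw g)
    rwa [hm, ← Finset.sum_mul, hlssum, one_mul] at this
  have hD1 : δmax < 1 := by
    rw [hδmax, Finset.sup'_lt_iff]
    intro g _
    rw [hδ]
    have := div_pos (hlam g) (hls g)
    linarith
  set N := Finset.univ.sup' Finset.univ_nonempty fun g => |δ g| with hNdef
  have hN : ∀ g, |δ g| ≤ N := fun g =>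
    Finset.le_sup' (fun g => |δ g|) (Finset.mem_univ g)
  have hN0 : 0 ≤ N := (abs_nonneg _).trans (hN (Classical.arbitrary _))
  obtain ⟨c, hcdef⟩ : ∃ c, c = 1 - δmax := ⟨_, rfl⟩
  rw [← hcdef]
  have hc : 0 < c := by linarith
  have hc1 : c ≤ 1 := by linarith
  have hcb : ∀ t ∈ Set.Icc (0:ℝ) 1, ∀ g, c ≤ 1 - t * δ g := by
    intro t ht g
    have := mul_le_mul_of_nonneg_left (hle g) ht.1
    nlinarith [ht.2]
  have hpos : ∀ t ∈ Set.Icc (0:ℝ) 1, ∀ g, 0 < 1 - t * δ g := fun t ht g => hc.trans_le (hcb t ht g)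
  set S := SS lamstar δ p with hS
  have hS1 : ∀ t ∈ Set.Icc (0:ℝ) 1, 1 ≤ S 0 t := fun t ht =>
    SS_ge lamstar δ hw hlssum hm p hp t (hpos t ht)
  have hd : ∀ k : ℕ, ∀ t ∈ Set.Icc (0:ℝ) 1, HasDerivAt (S k) ((p + k) * S (k + 1) t) t :=
    fun k t ht => SS_deriv lamstar δ p k t (hpos t ht)
  have hr : ∀ r : ℝ, ∀ t ∈ Set.Icc (0:ℝ) 1,
      HasDerivAt (fun t => S 0 t ^ r) (p * r * (S 0 t ^ (r - 1) * S 1 t)) t := by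
    intro r t ht
    have := (hd 0 t ht).rpow_const (p := r) (Or.inl (by linarith [hS1 t ht]))
    refine HasDerivAt.congr_deriv (this) ?_
    push_cast; ring
  have hT := taylor3 (fun t => S 0 t ^ (1 / p)) (fun t => S 0 t ^ (1 / p - 1) * S 1 t)
    (fun t => (p + 1) * (S 0 t ^ (1 / p - 1) * S 2 t)
      + (1 - p) * (S 0 t ^ (1 / p - 1 - 1) * S 1 t ^ 2))
    (fun t => (p + 1) * (p + 2) * (S 0 t ^ (1 / p - 1) * S 3 t)
      + 3 * ((1 - p) * (p + 1)) * (S 0 t ^ (1 / p - 1 - 1) * (S 1 t * S 2 t))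
      + (1 - p) * (1 - 2 * p) * (S 0 t ^ (1 / p - 1 - 1 - 1) * S 1 t ^ 3))
    (p ^ 2 * (N ^ 3 * ((c ^ (-p)) ^ 3 * c⁻¹ ^ 3)))
    (fun t ht => by
      refine HasDerivAt.congr_deriv (hr (1 / p) t ht) ?_
      field_simp)
    (fun t ht => by
      refine HasDerivAt.congr_deriv ((hr (1 / p - 1) t ht).fun_mul (hd 1 t ht)) ?_
      have : p * (1 / p - 1) = 1 - p := by field_simp
      rw [this]
      push_cast; ring)
    (fun t ht => by
      refine HasDerivAt.congr_deriv ((((hr (1 / p - 1) t ht).fun_mul (hd 2 t ht)).const_mul (p + 1)).fun_add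
        (((hr (1 / p - 1 - 1) t ht).fun_mul ((hd 1 t ht).fun_pow 2)).const_mul (1 - p))) ?_
      have e1 : p * (1 / p - 1) = 1 - p := by field_simp
      have e2 : p * (1 / p - 1 - 1) = 1 - 2 * p := by field_simp; ring
      rw [e1, e2]
      push_cast; ring)
    (fun t ht => by
      have hpi : 1 / p ≤ 1 := by rw [div_le_one (by linarith)]; exact hp
      have hb := fun k => SS_bd lamstar δ hw hlssum p hp k t c N hc (hcb t ht) hN
      have hSt := hS1 t ht
      have hq0 : ∀ r : ℝ, 0 ≤ S 0 t ^ r := fun r => rpow_nonneg (by linarith) _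
      have hq1 : ∀ r : ℝ, r ≤ 0 → S 0 t ^ r ≤ 1 := fun r hr => rpow_le_one_of_one_le_of_nonpos hSt hr
      exact alg_bd p N _ _ _ _ _ _ _ _ hp hN0
        (one_le_rpow_of_pos_of_le_one_of_nonpos hc hc1 (by linarith)) (inv_nonneg.2 hc.le)
        (hq0 _) (hq1 _ (by linarith)) (hq0 _) (hq1 _ (by linarith))
        (hq0 _) (hq1 _ (by linarith)) (hb 1) (hb 2) (hb 3))
  have s00 : S 0 0 = 1 := by simp [hS, SS, hlssum]
  have s10 : S 1 0 = 0 := by simp [hS, SS, hm]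
  have s20 : S 2 0 = ∑ g, lamstar g * δ g ^ 2 := by simp [hS, SS]
  have s01 : S 0 1 = ∑ g, lamstar g * (1 - δ g) ^ (-p) := by simp [hS, SS]
  have hc3 : c ^ (3 * p + 3) = ((c ^ (-p)) ^ 3 * c⁻¹ ^ 3)⁻¹ := by
    rw [rpow_neg hc.le, rpow_add hc, mul_comm 3 p, rpow_mul hc.le]
    have : ∀ x : ℝ, x ^ (3:ℝ) = x ^ 3 := fun x => by exact_mod_cast rpow_natCast x 3
    rw [this, this]
    simp [mul_comm]
  rw [hc3, div_inv_eq_mul]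
  simp only [s00, s10, s20, s01, one_rpow] at hT
  convert hT using 1
  · congr 1; ring
  · ring
end

section
/- Let G ≥ 1 be an integer, p ∈ [1,∞) a real, and λ ∈ Δ_G with λ_g > 0 for all g. Define r on U := {δ ∈ ℝ^G : δ_g < 1 for all g} by r(δ) := (Σ_{g=1}^G λ_g·(1−δ_g)^{−p})^{1/p}. Then for every δ ∈ U and all indices g, h, k, the third-order partial derivative satisfies ∂³r/∂δ_g∂δ_h∂δ_k (δ) = (p+1)(p+2)·r(δ)^{1−p}·1_{g=h=k}·λ_g·(1−δ_g)^{−(p+3)} + (p−1)(2p−1)·r(δ)^{1−3p}·λ_g λ_h λ_k·[(1−δ_g)(1−δ_h)(1−δ_k)]^{−(p+1)} − (p²−1)·r(δ)^{1−2p}·[ 1_{g=h}·λ_g λ_k·(1−δ_g)^{−(p+2)}(1−δ_k)^{−(p+1)} + 1_{h=k}·λ_h λ_g·(1−δ_h)^{−(p+2)}(1−δ_g)^{−(p+1)} + 1_{k=g}·λ_k λ_h·(1−δ_k)^{−(p+2)}(1−δ_h)^{−(p+1)} ]. -/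
open Finset Real

/-- `f` is differentiable at `x` and its `k`-th partial derivative there is `v`. -/
def PD {G : ℕ} (f : (Fin G → ℝ) → ℝ) (x : Fin G → ℝ) (k : Fin G) (v : ℝ) : Prop :=
  ∃ L : (Fin G → ℝ) →L[ℝ] ℝ, HasFDerivAt f L x ∧ L (Pi.single k 1) = v

lemma PD.mul {G : ℕ} {f₁ f₂ : (Fin G → ℝ) → ℝ} {x : Fin G → ℝ} {k : Fin G} {v w : ℝ}
    (hf : PD f₁ x k v) (hg : PD f₂ x k w) :
    PD (fun z => f₁ z * f₂ z) x k (f₁ x * w + f₂ x * v) := by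
  obtain ⟨L, hL, rfl⟩ := hf
  obtain ⟨M, hM, rfl⟩ := hg
  exact ⟨_, hL.mul hM, by simp⟩

lemma PD.add {G : ℕ} {f₁ f₂ : (Fin G → ℝ) → ℝ} {x : Fin G → ℝ} {k : Fin G} {v w : ℝ}
    (hf : PD f₁ x k v) (hg : PD f₂ x k w) :
    PD (fun z => f₁ z + f₂ z) x k (v + w) := by
  obtain ⟨L, hL, rfl⟩ := hf
  obtain ⟨M, hM, rfl⟩ := hg
  exact ⟨_, hL.add hM, by simp⟩

lemma PD.cmul {G : ℕ} {f₁ : (Fin G → ℝ) → ℝ} {x : Fin G → ℝ} {k : Fin G} {v : ℝ}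
    (c : ℝ) (hf : PD f₁ x k v) : PD (fun z => c * f₁ z) x k (c * v) := by
  obtain ⟨L, hL, rfl⟩ := hf
  exact ⟨_, hL.const_mul c, by simp⟩

lemma PD.rpow {G : ℕ} {f₁ : (Fin G → ℝ) → ℝ} {x : Fin G → ℝ} {k : Fin G} {v : ℝ}
    (q : ℝ) (hf : PD f₁ x k v) (h0 : 0 < f₁ x) :
    PD (fun z => f₁ z ^ q) x k (q * f₁ x ^ (q - 1) * v) := by
  obtain ⟨L, hL, rfl⟩ := hf
  exact ⟨_, hL.rpow_const (Or.inl h0.ne'), by simp⟩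

lemma PD.base {G : ℕ} (x : Fin G → ℝ) (g k : Fin G) :
    PD (fun z => 1 - z g) x k (-(if g = k then 1 else 0)) := by
  refine ⟨_, (hasFDerivAt_apply g x).const_sub 1, ?_⟩
  simp [Pi.single_apply]

lemma PD.sum {G : ℕ} {F : Fin G → (Fin G → ℝ) → ℝ} {x : Fin G → ℝ} {k : Fin G}
    {v : Fin G → ℝ} (hf : ∀ i, PD (F i) x k (v i)) :
    PD (fun z => ∑ i, F i z) x k (∑ i, v i) := by
  choose L hL hv using hf
  refine ⟨_, HasFDerivAt.fun_sum (fun i _ => hL i), ?_⟩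
  simp [hv]

lemma PD.fderiv_eq {G : ℕ} {f₁ f₂ : (Fin G → ℝ) → ℝ} {x : Fin G → ℝ} {k : Fin G} {v : ℝ}
    (hf : PD f₁ x k v) (hx : ∀ g, x g < 1)
    (he : ∀ z : Fin G → ℝ, (∀ g, z g < 1) → f₂ z = f₁ z) :
    fderiv ℝ f₂ x (Pi.single k 1) = v := by
  obtain ⟨L, hL, rfl⟩ := hf
  have hU : IsOpen {z : Fin G → ℝ | ∀ g, z g < 1} := by
    rw [Set.setOf_forall]
    exact isOpen_iInter_of_finite fun g => isOpen_lt (continuous_apply g) continuous_const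
  have : f₂ =ᶠ[nhds x] f₁ := by
    filter_upwards [hU.mem_nhds hx] with z hz using he z hz
  rw [this.fderiv_eq, hL.fderiv]

lemma PD.pw {G : ℕ} {x : Fin G → ℝ} (hx : ∀ g, x g < 1) (q : ℝ) (g k : Fin G) :
    PD (fun z => (1 - z g) ^ (-q)) x k ((if g = k then 1 else 0) * (q * (1 - x g) ^ (-(q + 1)))) := by
  have h := (PD.base x g k).rpow (-q) (by linarith [hx g])
  convert h using 1
  rw [show -(q + 1) = -q - 1 by ring]
  ring

lemma PD.S {G : ℕ} {x : Fin G → ℝ} (hx : ∀ g, x g < 1) (p : ℝ) (lam : Fin G → ℝ) (k : Fin G) :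
    PD (fun z => ∑ g, lam g * (1 - z g) ^ (-p)) x k (p * (lam k * (1 - x k) ^ (-(p + 1)))) := by
  have h := PD.sum (fun g => (PD.pw hx p g k).cmul (lam g))
  convert h using 1
  simp
  ring


/-- Third-order partial derivatives of the normalized performance ratio
`r(δ) = (∑ λ_g (1-δ_g)^{-p})^{1/p}` at any `δ` with all `δ_g < 1`. -/
theorem stmt9 (G : ℕ) (hG : 1 ≤ G) (p : ℝ) (hp : 1 ≤ p)
    (lam : Fin G → ℝ) (hlam : ∀ g, 0 < lam g) (hlamsum : ∑ g, lam g = 1)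
    (r : (Fin G → ℝ) → ℝ)
    (hr : ∀ δ : Fin G → ℝ, (∀ g, δ g < 1) →
      r δ = (∑ g, lam g * (1 - δ g) ^ (-p)) ^ (1 / p)) :
    ∀ δ : Fin G → ℝ, (∀ g, δ g < 1) → ∀ g h k : Fin G,
      fderiv ℝ (fun y => fderiv ℝ (fun z => fderiv ℝ r z (Pi.single g 1)) y
          (Pi.single h 1)) δ (Pi.single k 1)
        = (if g = h ∧ h = k then (1 : ℝ) else 0)
            * ((p + 1) * (p + 2) * r δ ^ (1 - p) * lam g * (1 - δ g) ^ (-(p + 3)))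
          + (p - 1) * (2 * p - 1) * r δ ^ (1 - 3 * p) * (lam g * lam h * lam k)
            * ((1 - δ g) * (1 - δ h) * (1 - δ k)) ^ (-(p + 1))
          - (p ^ 2 - 1) * r δ ^ (1 - 2 * p)
            * ((if g = h then (1 : ℝ) else 0)
                  * lam g * lam k * (1 - δ g) ^ (-(p + 2)) * (1 - δ k) ^ (-(p + 1))
              + (if h = k then (1 : ℝ) else 0)
                  * lam h * lam g * (1 - δ h) ^ (-(p + 2)) * (1 - δ g) ^ (-(p + 1))
              + (if k = g then (1 : ℝ) else 0)
                  * lam k * lam h * (1 - δ k) ^ (-(p + 2)) * (1 - δ h) ^ (-(p + 1))) := by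
  have hp0 : p ≠ 0 := by linarith
  have hS : ∀ x : Fin G → ℝ, (∀ g, x g < 1) → 0 < ∑ g, lam g * (1 - x g) ^ (-p) := by
    intro x hx
    haveI : Nonempty (Fin G) := ⟨⟨0, hG⟩⟩
    exact Finset.sum_pos (fun g _ => mul_pos (hlam g)
      (Real.rpow_pos_of_pos (by linarith [hx g]) _)) Finset.univ_nonempty
  have hSq : ∀ (q : ℝ) (x : Fin G → ℝ), (∀ g, x g < 1) → ∀ k,
      PD (fun z => (∑ g, lam g * (1 - z g) ^ (-p)) ^ q) x k
        (q * p * ((∑ g, lam g * (1 - x g) ^ (-p)) ^ (q - 1) *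
          (lam k * (1 - x k) ^ (-(p + 1))))) := by
    intro q x hx k
    convert (PD.S hx p lam k).rpow q (hS x hx) using 1
    ring
  intro δ hδ g h k
  have h1 : ∀ z : Fin G → ℝ, (∀ g, z g < 1) → fderiv ℝ r z (Pi.single g 1) =
      (∑ g, lam g * (1 - z g) ^ (-p)) ^ (1 / p - 1) * (lam g * (1 - z g) ^ (-(p + 1))) := by
    intro z hz
    rw [(hSq (1 / p) z hz g).fderiv_eq hz hr]
    field_simp
  have h2 : ∀ z : Fin G → ℝ, (∀ g, z g < 1) →
      fderiv ℝ (fun z => fderiv ℝ r z (Pi.single g 1)) z (Pi.single h 1) =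
      (1 - p) * lam g * lam h * ((∑ g, lam g * (1 - z g) ^ (-p)) ^ (1 / p - 2) *
        ((1 - z g) ^ (-(p + 1)) * (1 - z h) ^ (-(p + 1)))) +
      (if g = h then 1 else 0) * (p + 1) * lam g *
        ((∑ g, lam g * (1 - z g) ^ (-p)) ^ (1 / p - 1) * (1 - z g) ^ (-(p + 2))) := by
    intro z hz
    rw [((hSq (1 / p - 1) z hz h).mul ((PD.pw hz (p + 1) g h).cmul (lam g))).fderiv_eq hz h1]
    rw [show 1 / p - 1 - 1 = 1 / p - 2 by ring, show p + 1 + 1 = p + 2 by ring,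
      show (1 / p - 1) * p = 1 - p by field_simp]
    ring
  have h3 := ((((hSq (1 / p - 2) δ hδ k).mul
      ((PD.pw hδ (p + 1) g k).mul (PD.pw hδ (p + 1) h k))).cmul ((1 - p) * lam g * lam h)).add
      (((hSq (1 / p - 1) δ hδ k).mul (PD.pw hδ (p + 2) g k)).cmul
        ((if g = h then 1 else 0) * (p + 1) * lam g))).fderiv_eq hδ h2
  rw [h3]
  have hrp : ∀ q : ℝ, r δ ^ q = (∑ g, lam g * (1 - δ g) ^ (-p)) ^ (1 / p * q) := by
    intro q
    rw [hr δ hδ, ← Real.rpow_mul (hS δ hδ).le]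
  have hu : ∀ i, 0 ≤ 1 - δ i := fun i => by linarith [hδ i]
  rw [hrp, hrp, hrp, Real.mul_rpow (mul_nonneg (hu g) (hu h)) (hu k),
    Real.mul_rpow (hu g) (hu h)]
  rw [show 1 / p * (1 - p) = 1 / p - 1 by field_simp,
    show 1 / p * (1 - 2 * p) = 1 / p - 2 by field_simp,
    show 1 / p * (1 - 3 * p) = 1 / p - 3 by field_simp,
    show 1 / p - 1 - 1 = 1 / p - 2 by ring, show 1 / p - 2 - 1 = 1 / p - 3 by ring,
    show p + 1 + 1 = p + 2 by ring, show p + 2 + 1 = p + 3 by ring,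
    show (1 / p - 1) * p = 1 - p by field_simp, show (1 / p - 2) * p = 1 - 2 * p by field_simp]
  generalize (∑ g, lam g * (1 - δ g) ^ (-p)) ^ (1 / p - 1) = A
  generalize (∑ g, lam g * (1 - δ g) ^ (-p)) ^ (1 / p - 2) = B
  generalize (∑ g, lam g * (1 - δ g) ^ (-p)) ^ (1 / p - 3) = C
  by_cases e1 : g = h
  · subst e1
    by_cases e2 : g = k
    · subst e2
      simp only [and_self, if_true]
      ring
    · have e3 : ¬ k = g := fun e => e2 e.symm
      simp only [e2, e3, and_false, if_true, if_false]
      ring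
  · by_cases e2 : g = k
    · subst e2
      have e3 : ¬ h = g := fun e => e1 e.symm
      simp only [e1, e3, and_false, if_true, if_false]
      ring
    · have e3 : ¬ k = g := fun e => e2 e.symm
      by_cases e4 : h = k
      · subst e4
        simp only [e1, e3, false_and, if_true, if_false]
        ring
      · simp only [e1, e2, e3, e4, false_and, if_false]
        ring
end

section
/- Let G ≥ 1 be an integer, p ≥ 1 a real, t ∈ [0,1], λ ∈ Δ_G, and δ ∈ ℝ^G with Σ_{g=1}^G λ_g·δ_g = 0 and δ_max := max_g δ_g < 1. Then −δ_max ≤ Σ_{g=1}^G λ_g·δ_g/(1−t·δ_g)^{p+1} ≤ δ_max/(1−δ_max)^{p+1}. -/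
open Finset Real

/-- Bounds on the weighted sum `∑ λ_g δ_g/(1-tδ_g)^{p+1}` for `δ` orthogonal to the
probability vector `λ` with `δ_max < 1` and `t ∈ [0,1]`:
`-δ_max ≤ ∑ λ_g δ_g/(1-tδ_g)^{p+1} ≤ δ_max/(1-δ_max)^{p+1}`. -/
theorem stmt11 (G : ℕ) [Nonempty (Fin G)] (hG : 1 ≤ G) (p t : ℝ) (hp : 1 ≤ p)
    (ht : t ∈ Set.Icc (0 : ℝ) 1)
    (lam : Fin G → ℝ) (hlam : ∀ g, 0 ≤ lam g) (hlamsum : ∑ g, lam g = 1)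
    (δ : Fin G → ℝ) (horth : ∑ g, lam g * δ g = 0)
    (δmax : ℝ) (hδmax : δmax = Finset.univ.sup' Finset.univ_nonempty δ)
    (hδ1 : δmax < 1) :
    -δmax ≤ ∑ g, lam g * δ g / (1 - t * δ g) ^ (p + 1)
    ∧ ∑ g, lam g * δ g / (1 - t * δ g) ^ (p + 1) ≤ δmax / (1 - δmax) ^ (p + 1) := by
  obtain ⟨ht0, ht1⟩ := ht
  have hle : ∀ g, δ g ≤ δmax := fun g => by
    rw [hδmax]; exact Finset.le_sup' δ (Finset.mem_univ g)
  have hm0 : 0 ≤ δmax := by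
    have h : ∑ g, lam g * δ g ≤ ∑ g, lam g * δmax :=
      Finset.sum_le_sum fun g _ => mul_le_mul_of_nonneg_left (hle g) (hlam g)
    rw [← Finset.sum_mul, hlamsum, horth] at h
    linarith
  have hp0 : 0 ≤ p + 1 := by linarith
  have hden : 0 < (1 - δmax) ^ (p + 1) := Real.rpow_pos_of_pos (by linarith) _
  have htx : ∀ g, t * δ g ≤ δmax := fun g => by
    have h1 := mul_le_mul_of_nonneg_left (hle g) ht0
    nlinarith
  have hpos : ∀ g, 0 < (1 - t * δ g) ^ (p + 1) := fun g =>
    Real.rpow_pos_of_pos (by linarith [htx g]) _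
  constructor
  · have h : ∑ g, lam g * δ g ≤ ∑ g, lam g * δ g / (1 - t * δ g) ^ (p + 1) := by
      refine Finset.sum_le_sum fun g _ => ?_
      rw [mul_div_assoc]
      refine mul_le_mul_of_nonneg_left ?_ (hlam g)
      rw [le_div_iff₀ (hpos g)]
      rcases le_total 0 (δ g) with hx | hx
      · have : (1 - t * δ g) ^ (p + 1) ≤ 1 :=
          Real.rpow_le_one (by linarith [htx g]) (by linarith [mul_nonneg ht0 hx]) hp0
        nlinarith
      · have : 1 ≤ (1 - t * δ g) ^ (p + 1) :=
          Real.one_le_rpow (by linarith [mul_nonpos_of_nonneg_of_nonpos ht0 hx]) hp0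
        nlinarith
    linarith
  · have h : ∑ g, lam g * δ g / (1 - t * δ g) ^ (p + 1)
        ≤ ∑ g, lam g * (δmax / (1 - δmax) ^ (p + 1)) := by
      refine Finset.sum_le_sum fun g _ => ?_
      rw [mul_div_assoc]
      refine mul_le_mul_of_nonneg_left ?_ (hlam g)
      rcases le_total 0 (δ g) with hx | hx
      · exact div_le_div₀ hm0 (hle g) hden
          (Real.rpow_le_rpow (by linarith) (by linarith [htx g]) hp0)
      · exact (div_nonpos_of_nonpos_of_nonneg hx (hpos g).le).trans
          (div_nonneg hm0 hden.le)
    rwa [← Finset.sum_mul, hlamsum, one_mul] at h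
end

section
/- Let G ≥ 2 be an integer, q ∈ [1,2] a real, and σ ∈ ℝ^G with σ_g > 0 for all g; for each g let w_g : ℕ → [0,∞) be nonincreasing. Let X : ℕ → {1,…,G} be a sequence of group selections, and for each group g and time t ∈ ℕ let n_{g,t} := #{s ∈ {1,…,t} : X_s = g}. Let u_{g,t} be real numbers satisfying σ_g ≤ u_{g,t} ≤ σ_g·(1 + w_g(n_{g,t})) for all g and t, and assume the greedy selection rule: for every t ≥ 0 and every g, u_{X_{t+1},t}^q / n_{X_{t+1},t} ≥ u_{g,t}^q / n_{g,t}, where ratios are taken in [0,+∞] with a/0 = +∞ for a > 0. Then for every t ≥ 1 and all groups g, h with n_{h,t} ≥ 2, one has n_{g,t} ≥ 1 and σ_g^q / n_{g,t} ≤ σ_h^q·(1 + w_h(n_{h,t} − 1))^q / (n_{h,t} − 1). -/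
open Finset Real
open scoped ENNReal

/-- Structural inequality of Variance-UCB: if the upper confidence bounds satisfy
`σ_g ≤ u_{g,t} ≤ σ_g(1 + w_g(n_{g,t}))` and the algorithm greedily selects a maximizer
of `u_{g,t}^q/n_{g,t}` (ratios in `[0,+∞]` with `a/0 = +∞` for `a > 0`), then for every
`t ≥ 1` and groups `g, h` with `n_{h,t} ≥ 2`, one has `n_{g,t} ≥ 1` and
`σ_g^q/n_{g,t} ≤ σ_h^q (1 + w_h(n_{h,t}-1))^q/(n_{h,t}-1)`. -/
theorem stmt15 (G : ℕ) (hG : 2 ≤ G) (q : ℝ) (hq : 1 ≤ q) (hq2 : q ≤ 2)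
    (σ : Fin G → ℝ) (hσ : ∀ g, 0 < σ g)
    (w : Fin G → ℕ → ℝ) (hw : ∀ g, Antitone (w g)) (hwpos : ∀ g m, 0 ≤ w g m)
    (X : ℕ → Fin G)
    (n : Fin G → ℕ → ℕ)
    (hn : ∀ g t, n g t = ((Finset.Icc 1 t).filter (fun s => X s = g)).card)
    (u : Fin G → ℕ → ℝ)
    (hu : ∀ g t, σ g ≤ u g t ∧ u g t ≤ σ g * (1 + w g (n g t)))
    (hgreedy : ∀ t : ℕ, ∀ g : Fin G,
      ENNReal.ofReal (u g t ^ q) / (n g t : ℝ≥0∞)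
        ≤ ENNReal.ofReal (u (X (t + 1)) t ^ q) / (n (X (t + 1)) t : ℝ≥0∞)) :
    ∀ t : ℕ, 1 ≤ t → ∀ g h : Fin G, 2 ≤ n h t →
      1 ≤ n g t
      ∧ σ g ^ q / (n g t : ℝ)
          ≤ σ h ^ q * (1 + w h (n h t - 1)) ^ q / ((n h t : ℝ) - 1) := by
  have hstep : ∀ g t, n g (t + 1) = n g t + if X (t + 1) = g then 1 else 0 := by
    intro g t
    rw [hn, hn, Finset.card_filter, Finset.card_filter,
      Finset.sum_Icc_succ_top (by omega)]
  have hmono : ∀ g t, n g t ≤ n g (t + 1) := by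
    intro g t
    rw [hstep]
    omega
  have hq0 : 0 ≤ q := by linarith
  intro t _
  induction t with
  | zero =>
    intro g h hh
    rw [hn] at hh
    simp at hh
  | succ t ih =>
    intro g h hh
    have key : 1 ≤ n g t ∧ σ g ^ q / (n g t : ℝ)
          ≤ σ h ^ q * (1 + w h (n h (t + 1) - 1)) ^ q / ((n h (t + 1) : ℝ) - 1) := by
      by_cases hX : X (t + 1) = h
      · have e : n h (t + 1) = n h t + 1 := by rw [hstep, if_pos hX]
        have h1 : 1 ≤ n h t := by omega
        have gr := hgreedy t g
        rw [hX] at gr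
        have ug : 0 < u g t := lt_of_lt_of_le (hσ g) (hu g t).1
        have uh : 0 < u h t := lt_of_lt_of_le (hσ h) (hu h t).1
        have hg1 : 1 ≤ n g t := by
          by_contra hc
          have h0 : n g t = 0 := by omega
          have hpos : ENNReal.ofReal (u g t ^ q) ≠ 0 := by
            have := Real.rpow_pos_of_pos ug q
            simpa using this
          rw [h0, Nat.cast_zero, ENNReal.div_zero hpos, top_le_iff] at gr
          have hne : (n h t : ℝ≥0∞) ≠ 0 := by
            exact_mod_cast (by omega : n h t ≠ 0)
          exact ENNReal.div_ne_top ENNReal.ofReal_ne_top hne gr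
        have pg : (0 : ℝ) < n g t := by exact_mod_cast hg1
        have ph : (0 : ℝ) < n h t := by exact_mod_cast h1
        refine ⟨hg1, ?_⟩
        rw [← ENNReal.ofReal_natCast, ← ENNReal.ofReal_natCast,
          ← ENNReal.ofReal_div_of_pos pg, ← ENNReal.ofReal_div_of_pos ph,
          ENNReal.ofReal_le_ofReal_iff (by positivity)] at gr
        have e2 : ((n h (t + 1) : ℕ) : ℝ) - 1 = n h t := by rw [e]; push_cast; ring
        have e3 : n h (t + 1) - 1 = n h t := by omega
        have hw0 := hwpos h (n h t)
        rw [e2, e3, ← Real.mul_rpow (hσ h).le (by linarith)]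
        calc σ g ^ q / (n g t : ℝ) ≤ u g t ^ q / (n g t : ℝ) := by
              have := Real.rpow_le_rpow (hσ g).le (hu g t).1 hq0
              gcongr
          _ ≤ u h t ^ q / (n h t : ℝ) := gr
          _ ≤ _ := by
              have := Real.rpow_le_rpow uh.le (hu h t).2 hq0
              gcongr
      · have e : n h (t + 1) = n h t := by rw [hstep, if_neg hX]; rfl
        rw [e] at hh ⊢
        have ht : 1 ≤ t := by
          by_contra hc
          have h0 : t = 0 := by omega
          rw [h0, hn] at hh
          simp at hh
        exact ih ht g h hh
    refine ⟨key.1.trans (hmono g t), le_trans ?_ key.2⟩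
    have pg : (0 : ℝ) < n g t := by exact_mod_cast key.1
    have := Real.rpow_pos_of_pos (hσ g) q
    have := hmono g t
    gcongr
end

section
/- Let G ≥ 1 be an integer, q ∈ [1,2] a real, T > 0 a real, and λ ∈ ℝ^G with λ_g > 0, Σ_{g=1}^G λ_g = 1, and λ_g·T ≥ 2 for all g; set n*_g := λ_g·T. For each g let w_g : [0,∞) → [0,∞) be nonincreasing. Let n ∈ ℝ^G with n_g > 0 for all g and Σ_{g=1}^G n_g = T, and assume that for all g, h with n_h > 1: n*_g/n_g ≤ n*_h·(1 + w_h(n_h − 1))^q / (n_h − 1). Then for every g, 1 − n_g/n*_g ≤ 1 − (1/2)/(1 + max_h w_h(λ_h·T/2))^q. -/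
open Finset Real

/-- Initial rate on the relative distance: under the structural inequality of
Variance-UCB, for every group `g`,
`1 - n_g/n*_g ≤ 1 - (1/2)/(1 + max_h w_h(λ_h T/2))^q`. -/
theorem stmt16 (G : ℕ) [Nonempty (Fin G)] (hG : 1 ≤ G) (q T : ℝ)
    (hq : 1 ≤ q) (hq2 : q ≤ 2) (hT : 0 < T)
    (lam : Fin G → ℝ) (hlam : ∀ g, 0 < lam g) (hlamsum : ∑ g, lam g = 1)
    (hlT : ∀ g, 2 ≤ lam g * T)
    (w : Fin G → ℝ → ℝ) (hw : ∀ g, AntitoneOn (w g) (Set.Ici 0))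
    (hwpos : ∀ g x, 0 ≤ x → 0 ≤ w g x)
    (n : Fin G → ℝ) (hn : ∀ g, 0 < n g) (hnsum : ∑ g, n g = T)
    (hstruct : ∀ g h, 1 < n h →
      (lam g * T) / n g ≤ (lam h * T) * (1 + w h (n h - 1)) ^ q / (n h - 1)) :
    ∀ g, 1 - n g / (lam g * T)
      ≤ 1 - (1 / 2)
          / (1 + Finset.univ.sup' Finset.univ_nonempty fun h => w h (lam h * T / 2)) ^ q := by
  intro g
  obtain ⟨h, -, hh⟩ : ∃ h ∈ (Finset.univ : Finset (Fin G)), lam h * T ≤ n h := by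
    apply Finset.exists_le_of_sum_le Finset.univ_nonempty
    rw [← Finset.sum_mul, hlamsum, hnsum, one_mul]
  set M := Finset.univ.sup' Finset.univ_nonempty fun h => w h (lam h * T / 2) with hM
  have h2 := hlT h
  have hg2 := hlT g
  have hng := hn g
  have hM1 : w h (lam h * T / 2) ≤ M :=
    Finset.le_sup' (fun h => w h (lam h * T / 2)) (Finset.mem_univ h)
  have hw1 : w h (n h - 1) ≤ M :=
    (hw h (Set.mem_Ici.2 (by linarith)) (Set.mem_Ici.2 (by linarith)) (by linarith)).trans hM1
  have hw0 : 0 ≤ w h (n h - 1) := hwpos h _ (by linarith)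
  have hs := hstruct g h (by linarith)
  have hP : (1 + w h (n h - 1)) ^ q ≤ (1 + M) ^ q :=
    Real.rpow_le_rpow (by linarith) (by linarith) (by linarith)
  have hP0 : 0 < (1 + M) ^ q := Real.rpow_pos_of_pos (by linarith) _
  have hR : (lam h * T) * (1 + w h (n h - 1)) ^ q / (n h - 1) ≤ 2 * (1 + M) ^ q := by
    rw [div_le_iff₀ (by linarith)]
    calc (lam h * T) * (1 + w h (n h - 1)) ^ q ≤ (lam h * T) * (1 + M) ^ q :=
          mul_le_mul_of_nonneg_left hP (by linarith)
      _ ≤ (2 * (n h - 1)) * (1 + M) ^ q :=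
          mul_le_mul_of_nonneg_right (by linarith) hP0.le
      _ = _ := by ring
  have hF := hs.trans hR
  rw [div_le_iff₀ hng] at hF
  have : (1 / 2) / (1 + M) ^ q ≤ n g / (lam g * T) := by
    rw [div_le_div_iff₀ hP0 (by linarith)]
    nlinarith
  linarith
end

section
/- Let G be a positive integer, T a real with G < T, q ∈ [1,2] a real, and λ ∈ ℝ^G with λ_g > 0 and Σ_{g=1}^G λ_g = 1; set n*_g := λ_g·T. For each g let w_g : ℝ → [0,+∞] be nonincreasing. Let n ∈ ℝ^G with n_g ≥ 1 for all g and Σ_{g=1}^G n_g = T, and assume that for all g, h: n_g·n*_h·(1 + w_h(n_h − 1))^q ≥ (n_h − 1)·n*_g, interpreted in [0,+∞] (the left side is +∞ whenever w_h(n_h−1) = +∞). Set δ_max := max_g (1 − n_g/n*_g). Then δ_max ≤ 1 − (1 − G/T)·(Σ_{h=1}^G λ_h·(1 + w_h(n*_h·(1 − δ_max) − 1))^q)^{−1}, with the conventions (1+∞)^q = +∞ and 1/+∞ = 0. -/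
open Finset
open scoped ENNReal

/-- Potential bounding of the maximal relative distance: under the product-form
structural inequality of Variance-UCB (interpreted in `[0,+∞]`), the maximal relative
distance `δ_max = max_g (1 - n_g/n*_g)` is a postfixed point of the potential function:
`δ_max ≤ 1 - (1 - G/T)·(∑ λ_h (1 + w_h(n*_h(1-δ_max)-1))^q)⁻¹`, with the conventions
`(1+∞)^q = ∞` and `1/∞ = 0`. -/
theorem stmt17 (G : ℕ) [Nonempty (Fin G)] (hG : 0 < G) (T q : ℝ) (hGT : (G : ℝ) < T)
    (hq : 1 ≤ q) (hq2 : q ≤ 2)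
    (lam : Fin G → ℝ) (hlam : ∀ g, 0 < lam g) (hlamsum : ∑ g, lam g = 1)
    (w : Fin G → ℝ → ℝ≥0∞) (hw : ∀ g, Antitone (w g))
    (n : Fin G → ℝ) (hn : ∀ g, 1 ≤ n g) (hnsum : ∑ g, n g = T)
    (hstruct : ∀ g h, ENNReal.ofReal ((n h - 1) * (lam g * T))
        ≤ ENNReal.ofReal (n g * (lam h * T)) * (1 + w h (n h - 1)) ^ q)
    (δmax : ℝ)
    (hδmax : δmax = Finset.univ.sup' Finset.univ_nonempty
      (fun g => 1 - n g / (lam g * T))) :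
    δmax ≤ 1 - (1 - (G : ℝ) / T) *
      ((∑ h, ENNReal.ofReal (lam h)
          * (1 + w h (lam h * T * (1 - δmax) - 1)) ^ q)⁻¹).toReal := by
  have hT : 0 < T := lt_of_le_of_lt (Nat.cast_nonneg G) hGT
  obtain ⟨g, -, hg⟩ := Finset.exists_mem_eq_sup' (Finset.univ_nonempty (α := Fin G))
    (fun g => 1 - n g / (lam g * T))
  rw [← hδmax] at hg
  have hle : ∀ h, 1 - n h / (lam h * T) ≤ δmax := by
    intro h
    rw [hδmax]
    exact Finset.le_sup' (fun g => 1 - n g / (lam g * T)) (Finset.mem_univ h)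
  have hlT : ∀ h, 0 < lam h * T := fun h => mul_pos (hlam h) hT
  have hng : n g = lam g * T * (1 - δmax) := by
    have := (hlT g).ne'
    rw [hg]
    simp only [sub_sub_cancel]
    rw [mul_div_cancel₀ _ this]
  have hngpos : 0 < n g := lt_of_lt_of_le one_pos (hn g)
  have hδ : 0 < 1 - δmax := by
    rw [hng] at hngpos
    exact (mul_pos_iff_of_pos_left (hlT g)).1 hngpos
  have hnh : ∀ h, lam h * T * (1 - δmax) ≤ n h := by
    intro h
    have h1 : 1 - δmax ≤ n h / (lam h * T) := by linarith [hle h]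
    rw [le_div_iff₀ (hlT h)] at h1
    linarith
  set S := ∑ h, ENNReal.ofReal (lam h)
          * (1 + w h (lam h * T * (1 - δmax) - 1)) ^ q with hS
  have key : ENNReal.ofReal ((T - G) * (lam g * T)) ≤ ENNReal.ofReal (n g * T) * S := by
    have e : (T - G) * (lam g * T) = ∑ h, (n h - 1) * (lam g * T) := by
      rw [← Finset.sum_mul, Finset.sum_sub_distrib, hnsum]
      simp
    rw [e, ENNReal.ofReal_sum_of_nonneg, hS, Finset.mul_sum]
    · refine Finset.sum_le_sum fun h _ => (hstruct g h).trans ?_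
      have e2 : n g * (lam h * T) = n g * T * lam h := by ring
      rw [e2, ENNReal.ofReal_mul (by positivity), mul_assoc]
      have hwh : w h (n h - 1) ≤ w h (lam h * T * (1 - δmax) - 1) :=
        hw h (by linarith [hnh h])
      have h3 : (1 + w h (n h - 1)) ^ q ≤ (1 + w h (lam h * T * (1 - δmax) - 1)) ^ q :=
        ENNReal.rpow_le_rpow (add_le_add le_rfl hwh) (by linarith)
      gcongr
    · intro h _
      exact mul_nonneg (by linarith [hn h]) (hlT g).le
  clear_value S
  by_cases hSt : S = ∞
  · rw [hSt]
    simp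
    linarith
  rw [ENNReal.toReal_inv]
  have key2 : (T - G) * (lam g * T) ≤ n g * T * S.toReal := by
    rw [← ENNReal.ofReal_toReal hSt, ← ENNReal.ofReal_mul (by positivity)] at key
    exact (ENNReal.ofReal_le_ofReal_iff (by positivity)).1 key
  rcases (ENNReal.toReal_nonneg (a := S)).eq_or_lt with h0 | h0
  · rw [← h0]
    simp
    linarith
  have key3 : T - G ≤ (1 - δmax) * S.toReal * T := by
    rw [hng] at key2
    refine le_of_mul_le_mul_right ?_ (hlT g)
    linarith
  have key4 : (1 - (G : ℝ) / T) ≤ (1 - δmax) * S.toReal := by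
    rw [one_sub_div hT.ne', div_le_iff₀ hT]
    exact key3
  have : (1 - (G : ℝ) / T) * S.toReal⁻¹ ≤ 1 - δmax := by
    rw [← div_eq_mul_inv, div_le_iff₀ h0]
    exact key4
  linarith
end

section
/- Let G ≥ 1 be an integer, q ∈ [1,2] a real, T > 0 a real, and λ ∈ ℝ^G with λ_g > 0, Σ_{g=1}^G λ_g = 1, and λ_g·T ≥ 1 for all g; set n*_g := λ_g·T. For each g let w_g : [0,∞) → [0,∞) be nonincreasing. Let n ∈ ℝ^G with n_g > 0 for all g and Σ_{g=1}^G n_g = T, and assume that for all g, h with n_h ≥ 1: n_g/n*_g ≥ (n_h − 1)/(n*_h·(1 + w_h(n_h − 1))^q). Then for every h, 1 − n_h/n*_h ≥ −[ 1/n*_h + ((1 + w_h(n*_h − 1))^q − 1) ]. -/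
open Finset Real

/-- Lower bound on the relative distance: under the structural inequality of
Variance-UCB, for every group `h`,
`1 - n_h/n*_h ≥ -[1/n*_h + ((1 + w_h(n*_h - 1))^q - 1)]`. -/
theorem stmt18 (G : ℕ) (hG : 1 ≤ G) (q T : ℝ) (hq : 1 ≤ q) (hq2 : q ≤ 2) (hT : 0 < T)
    (lam : Fin G → ℝ) (hlam : ∀ g, 0 < lam g) (hlamsum : ∑ g, lam g = 1)
    (hlT : ∀ g, 1 ≤ lam g * T)
    (w : Fin G → ℝ → ℝ) (hw : ∀ g, AntitoneOn (w g) (Set.Ici 0))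
    (hwpos : ∀ g x, 0 ≤ x → 0 ≤ w g x)
    (n : Fin G → ℝ) (hn : ∀ g, 0 < n g) (hnsum : ∑ g, n g = T)
    (hstruct : ∀ g h, 1 ≤ n h →
      (n h - 1) / (lam h * T * (1 + w h (n h - 1)) ^ q) ≤ n g / (lam g * T)) :
    ∀ h, -(1 / (lam h * T) + ((1 + w h (lam h * T - 1)) ^ q - 1))
      ≤ 1 - n h / (lam h * T) := by
  intro h
  have hs := hlT h
  have hpos : 0 < lam h * T := by linarith
  have hw1 : 0 ≤ w h (lam h * T - 1) := hwpos h _ (by linarith)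
  have hW : 1 ≤ (1 + w h (lam h * T - 1)) ^ q :=
    Real.one_le_rpow (by linarith) (by linarith)
  have hinv : 0 < 1 / (lam h * T) := by positivity
  rcases le_or_gt (n h) (lam h * T) with hle | hgt
  · have : n h / (lam h * T) ≤ 1 := (div_le_one hpos).2 hle
    linarith
  · have hn1 : 1 ≤ n h := by linarith
    have hw2 : 0 ≤ w h (n h - 1) := hwpos h _ (by linarith)
    have hV : 0 < (1 + w h (n h - 1)) ^ q := Real.rpow_pos_of_pos (by linarith) _
    have hmono : (1 + w h (n h - 1)) ^ q ≤ (1 + w h (lam h * T - 1)) ^ q := by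
      apply Real.rpow_le_rpow (by linarith) _ (by linarith)
      have := hw h (Set.mem_Ici.2 (by linarith : (0:ℝ) ≤ lam h * T - 1))
        (Set.mem_Ici.2 (by linarith : (0:ℝ) ≤ n h - 1)) (by linarith)
      linarith
    set c := (n h - 1) / (lam h * T * (1 + w h (n h - 1)) ^ q) with hc
    have hsum : ∑ g, c * T * lam g ≤ ∑ g, n g := by
      apply Finset.sum_le_sum
      intro g _
      have h1 := hstruct g h hn1
      have h2 : 0 < lam g * T := mul_pos (hlam g) hT
      have h3 := (le_div_iff₀ h2).1 h1
      calc c * T * lam g = c * (lam g * T) := by ring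
        _ ≤ n g := h3
    rw [← Finset.mul_sum, hlamsum, hnsum, mul_one] at hsum
    have hc1 : c ≤ 1 := by
      by_contra hcon
      push Not at hcon
      nlinarith
    have h4 : n h - 1 ≤ lam h * T * (1 + w h (n h - 1)) ^ q :=
      (div_le_one (mul_pos hpos hV)).1 hc1
    have h5 : n h - 1 ≤ (1 + w h (lam h * T - 1)) ^ q * (lam h * T) := by
      nlinarith [mul_le_mul_of_nonneg_left hmono hpos.le]
    have h6 : (n h - 1) / (lam h * T) ≤ (1 + w h (lam h * T - 1)) ^ q :=
      (div_le_iff₀ hpos).2 h5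
    rw [sub_div] at h6
    linarith
end
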